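/- Let d = 1, σ = 0, and let P = T_0 be the ordinary Bergman projection on the unit disc U. With the Bloch seminorm ‖f‖_𝓑 = sup_{z∈U} (1-|z|²)^n |f^{(n)}(z)| (standard absolute value on ℂ), for every positive integer n, ‖P‖_{L^∞(U) → 𝓑} = 4(n+1)Γ(n)² / (n·Γ(n/2)²). -/

import Mathlib

open MeasureTheory Complex
open scoped ENNReal

noncomputable section

/-- The open unit disc in `ℂ`. -/
def unitDisc : Set ℂ := Metric.ball 0 1

/-- Lebesgue measure on `ℂ`, normalized so that the unit disc has measure one. -/
def normVolD : Measure ℂ := (volume unitDisc)⁻¹ • volume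

/-- The ordinary Bergman projection on the unit disc, `P f(z) = ∫_U f(w)/(1-z conj w)² dv(w)`. -/
def bergP (f : ℂ → ℂ) (z : ℂ) : ℂ :=
  ∫ w in unitDisc, f w / (1 - z * (starRingEnd ℂ) w) ^ (2 : ℕ) ∂normVolD

/-- Rising factorial over factorial. -/
def bc (s : ℝ) (k : ℕ) : ℝ := (∏ j ∈ Finset.range k, (s + j)) / (k.factorial : ℝ)

lemma bc_succ (s : ℝ) (k : ℕ) : bc s (k+1) = bc s k * (s + k) / (k + 1) := by
  unfold bc
  rw [Finset.prod_range_succ, Nat.factorial_succ]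
  push_cast
  have : (k.factorial : ℝ) ≠ 0 := by positivity
  field_simp

lemma bc_pos {s : ℝ} (hs : 0 < s) (k : ℕ) : 0 < bc s k := by
  unfold bc
  apply div_pos
  · exact Finset.prod_pos fun j _ => by positivity
  · positivity

lemma bc_eq_choose (s : ℝ) (k : ℕ) : Ring.choose ((s : ℂ) + k - 1) k = (bc s k : ℂ) := by
  have h : Ring.choose ((s : ℂ) + k - 1) k = Ring.multichoose (s : ℂ) k := by
    rw [Ring.choose]; congr 1; ring
  rw [h]
  have h2 := Ring.factorial_nsmul_multichoose_eq_ascPochhammer (s : ℂ) k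
  rw [Polynomial.ascPochhammer_smeval_eq_eval] at h2
  have h3 : (ascPochhammer ℂ k).eval (s : ℂ) = ∏ j ∈ Finset.range k, ((s : ℂ) + j) := by
    clear h h2
    induction k with
    | zero => simp
    | succ k ih => rw [ascPochhammer_succ_eval, ih, Finset.prod_range_succ]
  rw [h3, nsmul_eq_mul] at h2
  have : (k.factorial : ℂ) ≠ 0 := by exact_mod_cast Nat.factorial_ne_zero k
  unfold bc
  push_cast
  rw [← h2]
  field_simp

lemma bc_hasSum (s : ℝ) {u : ℂ} (hu : ‖u‖ < 1) :
    HasSum (fun k => (bc s k : ℂ) * u ^ k) (1 / (1 - u) ^ (s : ℂ)) := by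
  have h := Complex.one_div_one_sub_cpow_hasFPowerSeriesOnBall_zero (s : ℂ)
  have h2 := h.hasSum (y := u) (by
    rw [Metric.mem_eball, edist_zero_right, enorm_eq_nnnorm]
    exact_mod_cast hu)
  simpa [FormalMultilinearSeries.ofScalars_apply_eq, bc_eq_choose, smul_eq_mul, mul_comm] using h2

lemma bc_summable {s : ℝ} (hs : 0 < s) {x : ℝ} (h0 : 0 ≤ x) (hx : x < 1) :
    Summable (fun k => bc s k * x ^ k) := by
  have h := (bc_hasSum s (u := (x : ℂ)) (by simpa [abs_of_nonneg h0] using hx)).summable.norm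
  refine h.congr fun k => ?_
  simp [abs_of_nonneg h0, abs_of_pos (bc_pos hs k)]

lemma bc_hasSum_nat (n : ℕ) {x : ℝ} (h0 : 0 ≤ x) (hx : x < 1) :
    HasSum (fun k => bc n k * x ^ k) (1 / (1 - x) ^ n) := by
  have h := (bc_hasSum n (u := (x : ℂ)) (by simpa [abs_of_nonneg h0] using hx))
  have h2 := Complex.hasSum_re h
  convert h2 using 1
  · ext k
    rw [← Complex.ofReal_pow, ← Complex.ofReal_mul, Complex.ofReal_re]
  · rw [Complex.ofReal_natCast, Complex.cpow_natCast]
    rw [← Complex.ofReal_one, ← Complex.ofReal_sub, ← Complex.ofReal_pow, ← Complex.ofReal_div,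
      Complex.ofReal_re]

/-- coefficients of the kernel integral -/
def ac (n k : ℕ) : ℝ := bc ((n:ℝ)/2+1) k ^ 2 / (k + ((n:ℝ)/2+1))

lemma ac_pos (n k : ℕ) : 0 < ac n k := by
  unfold ac
  have := bc_pos (s := (n:ℝ)/2+1) (by positivity) k
  positivity

lemma ratio_mono (n : ℕ) (hn : 0 < n) : Monotone (fun k => ac n k / bc n k) := by
  apply monotone_nat_of_le_succ
  intro k
  have hn' : (1:ℝ) ≤ n := by exact_mod_cast hn
  have hb := bc_pos (s := (n:ℝ)) (by positivity) k
  have hc := bc_pos (s := (n:ℝ)/2+1) (by positivity) k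
  have hk : (0:ℝ) ≤ k := by positivity
  unfold ac
  rw [bc_succ, bc_succ]
  set B := bc n k
  set C := bc ((n:ℝ)/2+1) k
  push_cast
  generalize (n:ℝ) = m at *
  generalize (k:ℝ) = x at *
  have e1 : C ^ 2 / (x + (m / 2 + 1)) / B = (C^2 / B) * (1 / (x + (m/2+1))) := by
    field_simp
  have e2 : (C * (m / 2 + 1 + x) / (x + 1)) ^ 2 / (x + 1 + (m / 2 + 1)) / (B * (m + x) / (x + 1))
     = (C^2 / B) * ((m/2+1+x)^2 / ((x+1) * (x+1+(m/2+1)) * (m+x))) := by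
    field_simp
  rw [e1, e2]
  apply mul_le_mul_of_nonneg_left _ (by positivity)
  rw [div_le_div_iff₀ (by positivity) (by positivity)]
  nlinarith [mul_nonneg hk (sub_nonneg.2 hn'), sq_nonneg (m-1), mul_nonneg hk (sq_nonneg (m-1)), mul_nonneg (sub_nonneg.2 hn') (sq_nonneg (m-1))]

/-- the limit constant -/
def Lc (n : ℕ) : ℝ := Real.Gamma n / Real.Gamma ((n:ℝ)/2+1) ^ 2

lemma bc_gammaSeq {s : ℝ} (hs : 0 < s) (k : ℕ) (hk : 0 < k) :
    bc s k = (k:ℝ) ^ s / (Real.GammaSeq s k * (s + k)) := by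
  have hk' : (0:ℝ) < k := by exact_mod_cast hk
  unfold bc Real.GammaSeq
  rw [Finset.prod_range_succ]
  have h1 : 0 < ∏ j ∈ Finset.range k, (s + j) := Finset.prod_pos fun j _ => by positivity
  have h2 : 0 < (k:ℝ) ^ s := Real.rpow_pos_of_pos hk' s
  have : (0:ℝ) < k.factorial := by positivity
  field_simp

lemma ratio_tendsto (n : ℕ) (hn : 0 < n) :
    Filter.Tendsto (fun k => ac n k / bc n k) Filter.atTop (nhds (Lc n)) := by
  have hn' : (0:ℝ) < n := by exact_mod_cast hn
  have g1 := Real.GammaSeq_tendsto_Gamma (n:ℝ)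
  have g2 := Real.GammaSeq_tendsto_Gamma ((n:ℝ)/2+1)
  have hG : Real.Gamma ((n:ℝ)/2+1) ≠ 0 := (Real.Gamma_pos_of_pos (by positivity)).ne'
  have key : ∀ a : ℝ, Filter.Tendsto (fun k : ℕ => (a + k) / (k:ℝ)) Filter.atTop (nhds 1) := by
    intro a
    have h := (tendsto_const_div_atTop_nhds_zero_nat a).add_const 1
    rw [zero_add] at h
    refine h.congr' ?_
    filter_upwards [Filter.eventually_gt_atTop 0] with k hk
    have : (k:ℝ) ≠ 0 := by positivity
    field_simp
  have h := ((g1.div (g2.pow 2) (pow_ne_zero 2 hG)).mul ((key n).div ((key ((n:ℝ)/2+1)).pow 3) (by norm_num)))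
  have e : Real.Gamma n / Real.Gamma ((n:ℝ)/2+1) ^ 2 * (1 / 1^3) = Lc n := by
    unfold Lc; ring
  rw [e] at h
  refine h.congr' ?_
  filter_upwards [Filter.eventually_gt_atTop 0] with k hk
  have hk' : (0:ℝ) < k := by exact_mod_cast hk
  unfold ac
  rw [bc_gammaSeq hn' k hk, bc_gammaSeq (s := (n:ℝ)/2+1) (by positivity) k hk]
  have gp : ∀ s : ℝ, 0 < s → 0 < Real.GammaSeq s k := by
    intro s hs
    unfold Real.GammaSeq
    have h1 : 0 < ∏ j ∈ Finset.range (k+1), (s + j) := Finset.prod_pos fun j _ => by positivity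
    have h2 : 0 < (k:ℝ) ^ s := Real.rpow_pos_of_pos hk' s
    positivity
  have p1 := gp n hn'
  have p2 := gp ((n:ℝ)/2+1) (by positivity)
  have ep : ((k:ℝ) ^ ((n:ℝ)/2+1))^2 = (k:ℝ)^(n:ℝ) * (k:ℝ)^2 := by
    rw [← Real.rpow_natCast, ← Real.rpow_mul hk'.le, ← Real.rpow_natCast (k:ℝ) 2, ← Real.rpow_add hk']
    congr 1; push_cast; ring
  have p3 : 0 < (k:ℝ)^(n:ℝ) := Real.rpow_pos_of_pos hk' _
  simp only [Pi.div_apply]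
  rw [div_pow ((k:ℝ) ^ ((n:ℝ)/2+1)), ep]
  have q1 : 0 < (k:ℝ) + ((n:ℝ)/2+1) := by positivity
  have q2 : 0 < (n:ℝ)/2+1 + k := by positivity
  rw [add_comm (k:ℝ) ((n:ℝ)/2+1)]
  generalize (n:ℝ)/2+1 + k = Q at *
  generalize Real.GammaSeq ((n:ℝ)/2+1) k = G2 at *
  generalize Real.GammaSeq (n:ℝ) k = G1 at *
  generalize (k:ℝ)^(n:ℝ) = K at *
  field_simp

lemma ac_le (n : ℕ) (hn : 0 < n) (k : ℕ) : ac n k ≤ Lc n * bc n k := by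
  have h := (ratio_mono n hn).ge_of_tendsto (ratio_tendsto n hn) k
  rwa [div_le_iff₀ (bc_pos (by exact_mod_cast hn) k)] at h

lemma Lc_pos (n : ℕ) (hn : 0 < n) : 0 < Lc n := by
  have h1 := Real.Gamma_pos_of_pos (s := (n:ℝ)) (by exact_mod_cast hn)
  have h2 := Real.Gamma_pos_of_pos (s := (n:ℝ)/2+1) (by positivity)
  unfold Lc; positivity

lemma ac_summable (n : ℕ) (hn : 0 < n) {x : ℝ} (h0 : 0 ≤ x) (hx : x < 1) :
    Summable (fun k => ac n k * x ^ k) := by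
  refine Summable.of_nonneg_of_le (fun k => mul_nonneg (ac_pos n k).le (pow_nonneg h0 k)) ?_
    ((bc_hasSum_nat n h0 hx).summable.mul_left (Lc n))
  intro k
  rw [← mul_assoc]
  exact mul_le_mul_of_nonneg_right (ac_le n hn k) (pow_nonneg h0 k)

lemma ac_upper (n : ℕ) (hn : 0 < n) {x : ℝ} (h0 : 0 ≤ x) (hx : x < 1) :
    (1 - x) ^ n * ∑' k, ac n k * x ^ k ≤ Lc n := by
  have hs := (bc_hasSum_nat n h0 hx)
  have h : ∑' k, ac n k * x ^ k ≤ Lc n * (1 / (1-x)^n) := by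
    rw [← hs.tsum_eq, ← tsum_mul_left]
    refine (ac_summable n hn h0 hx).tsum_le_tsum ?_ (hs.summable.mul_left _)
    intro k
    rw [← mul_assoc]
    exact mul_le_mul_of_nonneg_right (ac_le n hn k) (pow_nonneg h0 k)
  have hp : 0 < (1 - x)^n := pow_pos (by linarith) n
  calc _ ≤ (1 - x) ^ n * (Lc n * (1 / (1-x)^n)) := mul_le_mul_of_nonneg_left h hp.le
    _ = Lc n := by field_simp

lemma ac_lower (n : ℕ) (hn : 0 < n) {c : ℝ} (hc : c < Lc n) :
    ∃ x : ℝ, 0 ≤ x ∧ x < 1 ∧ c < (1 - x) ^ n * ∑' k, ac n k * x ^ k := by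
  obtain ⟨d, hcd, hdL⟩ := exists_between hc
  have hev := (ratio_tendsto n hn).eventually (lt_mem_nhds hdL)
  obtain ⟨N, hN⟩ := Filter.eventually_atTop.1 hev
  have hbp : ∀ k, 0 < bc n k := fun k => bc_pos (by exact_mod_cast hn) k
  set M : ℝ := ∑ k ∈ Finset.range N, |d * bc n k| with hM
  have bound : ∀ x : ℝ, 0 ≤ x → x < 1 → d - (1-x)^n * M ≤ (1 - x) ^ n * ∑' k, ac n k * x ^ k := by
    intro x h0 hx
    have hs := (bc_hasSum_nat n h0 hx)
    have hp : 0 < (1 - x)^n := pow_pos (by linarith) n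
    have hsum : HasSum (fun k => if k ∈ Finset.range N then |d * bc n k| else 0) M := by
      have := hasSum_sum_of_ne_finset_zero (L := SummationFilter.unconditional ℕ) (s := Finset.range N)
        (f := fun k => if k ∈ Finset.range N then |d * bc n k| else 0) (fun k hk => if_neg hk)
      rwa [Finset.sum_congr rfl (fun k hk => if_pos hk)] at this
    have h : d * (1/(1-x)^n) ≤ (∑' k, ac n k * x ^ k) + M := by
      refine hasSum_le ?_ (hs.mul_left d) ((ac_summable n hn h0 hx).hasSum.add hsum)
      intro k
      have hxk := pow_nonneg h0 k
      have hxk1 : x^k ≤ 1 := pow_le_one₀ h0 hx.le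
      by_cases hk : k ∈ Finset.range N
      · simp only [hk, if_true]
        have h1 : d * (bc n k * x^k) ≤ |d * bc n k| * 1 := by
          rw [← mul_assoc]
          exact mul_le_mul (le_abs_self _) hxk1 hxk (abs_nonneg _)
        have := mul_nonneg (ac_pos n k).le hxk
        linarith
      · simp only [hk, if_false, add_zero]
        have h1 := hN k (by simpa using hk)
        rw [lt_div_iff₀ (hbp k)] at h1
        rw [← mul_assoc]
        exact mul_le_mul_of_nonneg_right h1.le hxk
    have h2 := mul_le_mul_of_nonneg_left h hp.le
    have h3 : (1-x)^n * (d * (1/(1-x)^n)) = d := by field_simp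
    rw [h3] at h2
    linarith [mul_add ((1-x)^n) (∑' k, ac n k * x ^ k) M]
  have ht : Filter.Tendsto (fun x : ℝ => d - (1-x)^n * M) (nhdsWithin 1 (Set.Iio 1)) (nhds d) := by
    have : Continuous (fun x : ℝ => d - (1-x)^n * M) := by fun_prop
    have h := (this.tendsto 1).mono_left (nhdsWithin_le_nhds (s := Set.Iio 1))
    simpa [hn.ne'] using h
  have h1 := ht.eventually (lt_mem_nhds hcd)
  have h2 : ∀ᶠ x : ℝ in nhdsWithin 1 (Set.Iio 1), x ∈ Set.Ioo 0 1 := Ioo_mem_nhdsLT (by norm_num)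
  obtain ⟨x, hx1, hx2⟩ := (h1.and h2).exists
  exact ⟨x, hx2.1.le, hx2.2, hx1.trans_le (bound x hx2.1.le hx2.2)⟩

/-- normalized measure on the disc -/
def dm : Measure ℂ := normVolD.restrict unitDisc

lemma dm_eq : dm = (volume unitDisc)⁻¹ • (volume.restrict unitDisc) := by
  unfold dm normVolD
  rw [Measure.restrict_smul]

lemma vol_disc : volume unitDisc = ENNReal.ofReal Real.pi := by
  unfold unitDisc
  rw [Complex.volume_ball]
  simp [← NNReal.coe_real_pi]

instance dm_fin : IsFiniteMeasure dm := by
  constructor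
  rw [dm_eq, Measure.smul_apply, Measure.restrict_apply_univ, vol_disc, smul_eq_mul,
    ENNReal.inv_mul_cancel]
  · exact ENNReal.one_lt_top
  · simp [Real.pi_pos]
  · exact ENNReal.ofReal_ne_top

lemma dm_ae : ∀ᵐ w ∂dm, ‖w‖ < 1 := by
  have h : MeasurableSet unitDisc := measurableSet_ball
  unfold dm
  filter_upwards [ae_restrict_mem h] with w hw
  simpa [unitDisc] using hw

lemma dm_integral (f : ℂ → ℂ) :
    ∫ w, f w ∂dm = (Real.pi : ℂ)⁻¹ * ∫ w in unitDisc, f w := by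
  rw [dm_eq, integral_smul_measure, vol_disc]
  rw [ENNReal.toReal_inv, ENNReal.toReal_ofReal Real.pi_pos.le]
  simp

lemma ang_int (j k : ℕ) : ∫ t in Set.Ioo (-Real.pi) Real.pi,
    cexp ((((k:ℂ) - j) * I) * (t:ℂ)) = if j = k then 2 * (Real.pi : ℂ) else 0 := by
  rw [← integral_Ioc_eq_integral_Ioo, ← intervalIntegral.integral_of_le (by linarith [Real.pi_pos])]
  split_ifs with h
  · subst h
    simp
    ring
  · have hc : ((k:ℂ) - j) * I ≠ 0 := by
      refine mul_ne_zero (sub_ne_zero.2 ?_) I_ne_zero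
      intro h2
      exact h (by exact_mod_cast h2.symm)
    rw [integral_exp_mul_complex hc]
    have : cexp (((k:ℂ) - j) * I * (Real.pi:ℝ)) = cexp (((k:ℂ) - j) * I * ((-Real.pi : ℝ):ℂ)) := by
      rw [Complex.exp_eq_exp_iff_exists_int]
      refine ⟨(k:ℤ) - j, ?_⟩
      push_cast
      ring
    rw [this]; simp

lemma rad_int (m : ℕ) : ∫ r in Set.Ioi (0:ℝ), (Set.Iio (1:ℝ)).indicator (fun r => ((r:ℂ)^m)) r
    = 1 / ((m:ℂ) + 1) := by
  rw [setIntegral_indicator measurableSet_Iio, Set.Ioi_inter_Iio, ← integral_Ioc_eq_integral_Ioo,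
    ← intervalIntegral.integral_of_le (by norm_num)]
  have : ∀ r : ℝ, (r:ℂ)^m = ((r^m : ℝ) : ℂ) := by intro r; push_cast; rfl
  simp_rw [this]
  rw [intervalIntegral.integral_ofReal, integral_pow]
  simp

lemma moment (n j k : ℕ) :
    ∫ w, ((starRingEnd ℂ) w) ^ j * w ^ k * ((‖w‖ ^ n : ℝ) : ℂ) ∂dm =
      if j = k then 1 / ((k:ℂ) + ((n:ℂ)/2+1)) else 0 := by
  rw [dm_integral, ← integral_indicator (by exact measurableSet_ball),
    ← Complex.integral_comp_polarCoord_symm]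
  have e : ∫ p in polarCoord.target, p.1 • unitDisc.indicator
      (fun w => ((starRingEnd ℂ) w) ^ j * w ^ k * ((‖w‖ ^ n : ℝ) : ℂ)) (Complex.polarCoord.symm p)
      = ∫ p in Set.Ioi (0:ℝ) ×ˢ Set.Ioo (-Real.pi) Real.pi,
        (Set.Iio (1:ℝ)).indicator (fun r => ((r:ℂ)^(j+k+n+1))) p.1 *
          cexp ((((k:ℂ) - j) * I) * (p.2:ℂ)) := by
    rw [polarCoord_target]
    refine setIntegral_congr_fun (measurableSet_Ioi.prod measurableSet_Ioo) ?_
    rintro ⟨r, t⟩ ⟨hr, ht⟩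
    simp only [Set.mem_Ioi] at hr
    have hs : Complex.polarCoord.symm (r, t) = r * cexp (t * I) := by
      rw [Complex.polarCoord_symm_apply, Complex.exp_mul_I]; simp
    have hnorm : ‖(r:ℂ) * cexp (t * I)‖ = r := by
      rw [norm_mul, Complex.norm_exp_ofReal_mul_I]; simp [abs_of_pos hr]
    simp only
    rw [hs]
    by_cases h1 : r < 1
    · rw [Set.indicator_of_mem (by simpa [unitDisc, abs_of_pos hr] using h1),
        Set.indicator_of_mem (by exact h1), hnorm]
      have hconj : (starRingEnd ℂ) ((r:ℂ) * cexp (t * I)) = r * cexp (-(t*I)) := by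
        rw [map_mul, Complex.conj_ofReal, ← Complex.exp_conj]
        simp
      rw [hconj, mul_pow, mul_pow, ← Complex.exp_nat_mul, ← Complex.exp_nat_mul]
      have he : cexp (((k:ℂ) - j) * I * t) = cexp ((j:ℂ) * -(t*I)) * cexp ((k:ℂ) * (t*I)) := by
        rw [← Complex.exp_add]; congr 1; ring
      rw [he, Complex.real_smul]
      push_cast
      ring
    · rw [Set.indicator_of_notMem (by simpa [unitDisc, abs_of_pos hr] using h1),
        Set.indicator_of_notMem (by exact h1)]
      simp
  rw [e, Measure.volume_eq_prod, setIntegral_prod_mul (fun r => (Set.Iio (1:ℝ)).indicator (fun r => ((r:ℂ)^(j+k+n+1))) r)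
    (fun t : ℝ => cexp ((((k:ℂ) - j) * I) * (t:ℂ))), rad_int, ang_int]
  split_ifs with h
  · subst h
    have hpi : (Real.pi : ℂ) ≠ 0 := by exact_mod_cast Real.pi_ne_zero
    have h1 : (j:ℂ) + ((n:ℂ)/2+1) ≠ 0 := by
      have : (0:ℝ) < (j:ℝ) + ((n:ℝ)/2+1) := by positivity
      have h9 : (((j:ℝ) + ((n:ℝ)/2+1) : ℝ) : ℂ) ≠ 0 := by exact_mod_cast this.ne'
      push_cast at h9
      exact h9
    have h2 : (((j+j+n+1 : ℕ):ℂ) + 1) = 2 * ((j:ℂ) + ((n:ℂ)/2+1)) := by push_cast; ring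
    rw [h2]
    field_simp
  · simp

lemma bdd_integrable {f : ℂ → ℂ} (hf : Measurable f) {C : ℝ} (h : ∀ w, ‖w‖ < 1 → ‖f w‖ ≤ C) :
    Integrable f dm := by
  refine Integrable.of_bound hf.aestronglyMeasurable C ?_
  filter_upwards [dm_ae] with w hw using h w hw

lemma mul_aux {f g : ℕ → ℂ} {a b : ℂ} (hf : HasSum f a) (hg : HasSum g b) :
    HasSum (fun p : ℕ × ℕ => f p.1 * g p.2) (a * b) :=
  hf.mul hg (summable_mul_of_summable_norm hf.summable.norm hg.summable.norm)

lemma pt_hasSum (n : ℕ) {z w : ℂ} (hz : ‖z‖ < 1) (hw : ‖w‖ < 1) :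
    HasSum (fun p : ℕ × ℕ => ((bc ((n:ℝ)/2+1) p.1 : ℂ) * (z * (starRingEnd ℂ) w) ^ p.1) *
      ((bc ((n:ℝ)/2+1) p.2 : ℂ) * ((starRingEnd ℂ) z * w) ^ p.2) * ((‖w‖ ^ n : ℝ) : ℂ))
      ((‖w‖ ^ n / ‖1 - z * (starRingEnd ℂ) w‖ ^ (n+2) : ℝ) : ℂ) := by
  set s : ℝ := (n:ℝ)/2+1 with hs
  have hu : ‖z * (starRingEnd ℂ) w‖ < 1 := by
    rw [norm_mul, RCLike.norm_conj]
    nlinarith [norm_nonneg z, norm_nonneg w]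
  have hu' : ‖(starRingEnd ℂ) z * w‖ < 1 := by
    rw [norm_mul, RCLike.norm_conj]
    nlinarith [norm_nonneg z, norm_nonneg w]
  have s1 := bc_hasSum s hu
  have s2 := bc_hasSum s hu'
  have hconj : 1 / (1 - (starRingEnd ℂ) z * w) ^ (s:ℂ) =
      (starRingEnd ℂ) (1 / (1 - z * (starRingEnd ℂ) w) ^ (s:ℂ)) := by
    refine s2.unique ?_
    have s4 := Complex.hasSum_conj'.2 s1
    have e4 : (fun k => (starRingEnd ℂ) ((bc s k : ℂ) * (z * (starRingEnd ℂ) w) ^ k)) =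
        fun k => (bc s k : ℂ) * ((starRingEnd ℂ) z * w) ^ k := by
      ext k
      simp
    rw [e4] at s4
    exact s4
  have s5 := mul_aux s1 s2
  rw [hconj, Complex.mul_conj, Complex.normSq_eq_norm_sq, norm_div, Complex.norm_cpow_real] at s5
  have hne : 0 < ‖1 - z * (starRingEnd ℂ) w‖ := by
    rw [norm_pos_iff, sub_ne_zero]
    rintro h
    rw [← h] at hu
    simp at hu
  have hp : (‖1 - z * (starRingEnd ℂ) w‖ ^ s) ^ 2 = ‖1 - z * (starRingEnd ℂ) w‖ ^ (n+2) := by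
    rw [← Real.rpow_natCast, ← Real.rpow_mul hne.le, ← Real.rpow_natCast]
    congr 1
    rw [hs]; push_cast; ring
  rw [div_pow, hp] at s5
  have s6 := s5.mul_right ((‖w‖ ^ n : ℝ) : ℂ)
  have e : ((‖w‖ ^ n / ‖1 - z * (starRingEnd ℂ) w‖ ^ (n+2) : ℝ) : ℂ) =
      ((‖(1:ℂ)‖ ^ 2 / ‖1 - z * (starRingEnd ℂ) w‖ ^ (n+2) : ℝ) : ℂ) * ((‖w‖ ^ n : ℝ) : ℂ) := by
    rw [← Complex.ofReal_mul, norm_one]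
    congr 1
    ring
  rw [e]
  exact s6

lemma kernel_int (n : ℕ) {z : ℂ} (hz : ‖z‖ < 1) :
    ∫ w, ‖w‖ ^ n / ‖1 - z * (starRingEnd ℂ) w‖ ^ (n+2) ∂dm = ∑' k, ac n k * (‖z‖^2) ^ k := by
  set s : ℝ := (n:ℝ)/2+1 with hs
  have hs0 : 0 < s := by positivity
  let F : ℕ × ℕ → ℂ → ℂ := fun p w =>
    ((bc s p.1 : ℂ) * (z * (starRingEnd ℂ) w) ^ p.1) * ((bc s p.2 : ℂ) * ((starRingEnd ℂ) z * w) ^ p.2)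
      * ((‖w‖ ^ n : ℝ) : ℂ)
  have hFm : ∀ p, Measurable (F p) := by
    intro p
    apply Continuous.measurable
    simp only [F]
    fun_prop
  let B : ℕ × ℕ → ℝ := fun p => (bc s p.1 * ‖z‖ ^ p.1) * (bc s p.2 * ‖z‖ ^ p.2)
  have hFb : ∀ p w, ‖w‖ < 1 → ‖F p w‖ ≤ B p := by
    intro p w hw
    have b1 := bc_pos hs0 p.1
    have b2 := bc_pos hs0 p.2
    have : ‖F p w‖ = B p * (‖w‖ ^ p.1 * ‖w‖ ^ p.2 * ‖w‖ ^ n) := by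
      simp only [F, B, norm_mul, norm_pow, Complex.norm_real, RCLike.norm_conj, Real.norm_eq_abs,
        abs_of_pos b1, abs_of_pos b2, mul_pow, abs_norm]
      ring
    rw [this]
    have hB : 0 ≤ B p := by simp only [B]; positivity
    have : ‖w‖ ^ p.1 * ‖w‖ ^ p.2 * ‖w‖ ^ n ≤ 1 := by
      rw [← pow_add, ← pow_add]
      exact pow_le_one₀ (norm_nonneg w) hw.le
    nlinarith
  have hBs : Summable B := by
    have h := (bc_summable hs0 (norm_nonneg z) hz)
    exact h.mul_of_nonneg h (fun k => mul_nonneg (bc_pos hs0 k).le (by positivity))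
      (fun k => mul_nonneg (bc_pos hs0 k).le (by positivity))
  have hFi : ∀ p, Integrable (F p) dm := fun p => bdd_integrable (hFm p) (hFb p)
  have hsum : Summable fun p => ∫ w, ‖F p w‖ ∂dm := by
    refine Summable.of_nonneg_of_le (fun p => integral_nonneg fun w => norm_nonneg _) ?_
      (hBs.mul_right (dm.real Set.univ))
    intro p
    calc ∫ w, ‖F p w‖ ∂dm ≤ ∫ w, B p ∂dm := by
          refine integral_mono_ae (hFi p).norm (integrable_const _) ?_
          filter_upwards [dm_ae] with w hw using hFb p w hw
      _ = B p * dm.real Set.univ := by rw [integral_const, smul_eq_mul, mul_comm]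
  have key := hasSum_integral_of_summable_integral_norm hFi hsum
  have hint : ∀ p : ℕ × ℕ, ∫ w, F p w ∂dm = (bc s p.1 : ℂ) * bc s p.2 * z ^ p.1 * (starRingEnd ℂ z) ^ p.2
      * (if p.1 = p.2 then 1 / ((p.2:ℂ) + ((n:ℂ)/2+1)) else 0) := by
    intro p
    rw [← moment n p.1 p.2, ← integral_const_mul]
    congr 1
    ext w
    simp only [F]
    ring
  have hlim : ∫ w, ∑' p, F p w ∂dm =
      ((∫ w, ‖w‖ ^ n / ‖1 - z * (starRingEnd ℂ) w‖ ^ (n+2) ∂dm : ℝ) : ℂ) := by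
    rw [← integral_complex_ofReal]
    refine integral_congr_ae ?_
    filter_upwards [dm_ae] with w hw
    exact (pt_hasSum n hz hw).tsum_eq
  rw [hlim] at key
  have hinj : Function.Injective (fun k : ℕ => (k, k)) := fun a b h => (Prod.mk.inj h).1
  have key2 := (hinj.hasSum_iff (f := fun p => ∫ w, F p w ∂dm) (by
    rintro ⟨a, b⟩ hab
    rw [hint]
    have : a ≠ b := by
      rintro rfl
      exact hab ⟨a, rfl⟩
    simp [this])).2 key
  have key3 := Complex.hasSum_re key2
  rw [Complex.ofReal_re] at key3
  rw [← key3.tsum_eq]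
  congr 1
  ext k
  simp only [Function.comp, hint, if_true]
  have : (bc s k : ℂ) * bc s k * z ^ k * (starRingEnd ℂ z) ^ k * (1 / ((k:ℂ) + ((n:ℂ)/2+1)))
    = ((ac n k * (‖z‖^2)^k : ℝ) : ℂ) := by
    have h : z ^ k * (starRingEnd ℂ z) ^ k = (((‖z‖^2)^k : ℝ) : ℂ) := by
      rw [← mul_pow, Complex.mul_conj, Complex.normSq_eq_norm_sq]; push_cast; rfl
    rw [mul_assoc ((bc s k : ℂ) * bc s k), h]
    unfold ac
    push_cast
    rw [← hs]
    ring
  rw [this, Complex.ofReal_re]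

lemma one_sub_lower {z w : ℂ} {ρ : ℝ} (hz : ‖z‖ ≤ ρ) (hw : ‖w‖ < 1) :
    1 - ρ ≤ ‖1 - z * (starRingEnd ℂ) w‖ := by
  have h1 := norm_sub_norm_le (1:ℂ) (z * (starRingEnd ℂ) w)
  rw [norm_one, norm_mul, RCLike.norm_conj] at h1
  have h2 : ‖z‖ * ‖w‖ ≤ ‖z‖ := mul_le_of_le_one_right (norm_nonneg z) hw.le
  linarith

lemma ker_meas (m : ℕ) (z : ℂ) :
    Measurable fun w : ℂ => (starRingEnd ℂ) w ^ m / (1 - z * (starRingEnd ℂ) w) ^ (m+2) := by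
  have h1 : Measurable fun w : ℂ => (starRingEnd ℂ) w := Complex.continuous_conj.measurable
  fun_prop

lemma ker_bound (m : ℕ) {z w : ℂ} {ρ : ℝ} (hρ : ρ < 1) (hz : ‖z‖ ≤ ρ) (hw : ‖w‖ < 1) :
    ‖(starRingEnd ℂ) w ^ m / (1 - z * (starRingEnd ℂ) w) ^ (m+2)‖ ≤ 1 / (1 - ρ) ^ (m+2) := by
  have h0 : 0 < 1 - ρ := by linarith
  have h := one_sub_lower hz hw
  rw [norm_div, norm_pow, norm_pow, RCLike.norm_conj]
  exact div_le_div₀ zero_le_one (pow_le_one₀ (norm_nonneg _) hw.le) (by positivity)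
    (pow_le_pow_left₀ h0.le h _)

lemma deriv_step (G : ℂ → ℂ) (hG : Measurable G) (hG1 : ∀ w, ‖G w‖ ≤ 1) (m : ℕ) {z : ℂ} (hz : ‖z‖ < 1) :
    HasDerivAt (fun z => ∫ w, G w * ((starRingEnd ℂ) w ^ m / (1 - z * (starRingEnd ℂ) w) ^ (m+2)) ∂dm)
      (((m:ℂ) + 2) * ∫ w, G w * ((starRingEnd ℂ) w ^ (m+1) / (1 - z * (starRingEnd ℂ) w) ^ (m+1+2)) ∂dm) z := by
  obtain ⟨ρ, hzρ, hρ⟩ := exists_between hz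
  rw [← integral_const_mul]
  refine (hasDerivAt_integral_of_dominated_loc_of_deriv_le (s := Metric.ball 0 ρ)
    (bound := fun _ => ((m:ℝ) + 2) * (1 / (1 - ρ) ^ (m+1+2)))
    (F' := fun z w => ((m:ℂ) + 2) * (G w * ((starRingEnd ℂ) w ^ (m+1) / (1 - z * (starRingEnd ℂ) w) ^ (m+1+2))))
    (Metric.isOpen_ball.mem_nhds (by simpa using hzρ)) ?_ ?_ ?_ ?_ (integrable_const _) ?_).2
  · exact Filter.Eventually.of_forall fun x => (hG.mul (ker_meas m x)).aestronglyMeasurable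
  · refine bdd_integrable (hG.mul (ker_meas m z)) (C := 1 * (1 / (1 - ρ) ^ (m+2))) fun w hw => ?_
    rw [norm_mul]
    exact mul_le_mul (hG1 w) (ker_bound m hρ hzρ.le hw) (norm_nonneg _) zero_le_one
  · exact ((hG.mul (ker_meas (m+1) z)).const_mul _).aestronglyMeasurable
  · filter_upwards [dm_ae] with w hw x hx
    have hx' : ‖x‖ ≤ ρ := by simpa using (Metric.mem_ball.1 hx).le
    rw [norm_mul, norm_mul]
    have e : ‖(m:ℂ) + 2‖ = (m:ℝ) + 2 := by
      have : (m:ℂ) + 2 = (((m:ℝ)+2 : ℝ) : ℂ) := by push_cast; rfl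
      rw [this, Complex.norm_real, Real.norm_eq_abs, abs_of_pos (by positivity)]
    rw [e]
    have := mul_le_mul (hG1 w) (ker_bound (m+1) hρ hx' hw) (norm_nonneg _) zero_le_one
    rw [one_mul] at this
    exact mul_le_mul_of_nonneg_left this (by positivity)
  · filter_upwards [dm_ae] with w hw x hx
    have hx' : ‖x‖ ≤ ρ := by simpa using (Metric.mem_ball.1 hx).le
    have hne : 1 - x * (starRingEnd ℂ) w ≠ 0 := by
      rw [← norm_pos_iff]
      linarith [one_sub_lower hx' hw]
    have h1 : HasDerivAt (fun x : ℂ => 1 - x * (starRingEnd ℂ) w) (-(starRingEnd ℂ) w) x := by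
      simpa using ((hasDerivAt_id x).mul_const ((starRingEnd ℂ) w)).const_sub 1
    have h2 := ((h1.pow (m+2)).inv (pow_ne_zero _ hne)).const_mul (G w * (starRingEnd ℂ) w ^ m)
    have e1 : (fun y : ℂ => G w * ((starRingEnd ℂ) w ^ m / (1 - y * (starRingEnd ℂ) w) ^ (m+2))) =
        fun y => G w * (starRingEnd ℂ) w ^ m * ((fun x => 1 - x * (starRingEnd ℂ) w) ^ (m + 2))⁻¹ y := by
      ext y
      simp only [Pi.inv_apply, Pi.pow_apply]
      rw [div_eq_mul_inv, mul_assoc]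
    rw [e1]
    refine h2.congr_deriv ?_
    simp only [Pi.pow_apply]
    have e : m + 2 - 1 = m + 1 := rfl
    rw [e]
    push_cast
    generalize (starRingEnd ℂ) w = v at *
    field_simp
    try ring

lemma iter_formula (G : ℂ → ℂ) (hG : Measurable G) (hG1 : ∀ w, ‖G w‖ ≤ 1) (m : ℕ) :
    ∀ z : ℂ, ‖z‖ < 1 → iteratedDeriv m (bergP G) z = ((m+1).factorial : ℂ) *
      ∫ w, G w * ((starRingEnd ℂ) w ^ m / (1 - z * (starRingEnd ℂ) w) ^ (m+2)) ∂dm := by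
  induction m with
  | zero =>
    intro z hz
    simp only [iteratedDeriv_zero, bergP, dm]
    simp [div_eq_mul_inv]
  | succ m ih =>
    intro z hz
    rw [iteratedDeriv_succ]
    have hev : iteratedDeriv m (bergP G) =ᶠ[nhds z] fun z => ((m+1).factorial : ℂ) *
      ∫ w, G w * ((starRingEnd ℂ) w ^ m / (1 - z * (starRingEnd ℂ) w) ^ (m+2)) ∂dm := by
      filter_upwards [Metric.isOpen_ball.mem_nhds (show z ∈ Metric.ball (0:ℂ) 1 by simpa using hz)] with x hx
      exact ih x (by simpa using hx)
    rw [hev.deriv_eq, ((deriv_step G hG hG1 m hz).const_mul _).deriv, ← mul_assoc]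
    congr 1
    rw [Nat.factorial_succ (m+1)]
    push_cast
    ring

lemma norm_ker_int (n : ℕ) {z : ℂ} (hz : ‖z‖ < 1) :
    ∫ w, ‖(starRingEnd ℂ) w ^ n / (1 - z * (starRingEnd ℂ) w) ^ (n+2)‖ ∂dm =
      ∑' k, ac n k * (‖z‖^2) ^ k := by
  rw [← kernel_int n hz]
  congr 1
  ext w
  rw [norm_div, norm_pow, norm_pow, RCLike.norm_conj]

lemma upper_bd (n : ℕ) (hn : 0 < n) (G : ℂ → ℂ) (hG : Measurable G) (hG1 : ∀ w, ‖G w‖ ≤ 1) {z : ℂ} (hz : ‖z‖ < 1) :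
    (1 - ‖z‖ ^ 2) ^ n * ‖iteratedDeriv n (bergP G) z‖ ≤ ((n+1).factorial : ℝ) * Lc n := by
  have hz2 : ‖z‖^2 < 1 := by nlinarith [norm_nonneg z]
  have hp : 0 ≤ (1 - ‖z‖^2)^n := pow_nonneg (by linarith) n
  rw [iter_formula G hG hG1 n z hz, norm_mul, Complex.norm_natCast]
  have h1 : ‖∫ w, G w * ((starRingEnd ℂ) w ^ n / (1 - z * (starRingEnd ℂ) w) ^ (n+2)) ∂dm‖ ≤
      ∑' k, ac n k * (‖z‖^2) ^ k := by
    rw [← norm_ker_int n hz]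
    refine norm_integral_le_of_norm_le
      (bdd_integrable (ker_meas n z) (fun w hw => ker_bound n hz le_rfl hw)).norm ?_
    refine Filter.Eventually.of_forall fun w => ?_
    rw [norm_mul]
    exact mul_le_of_le_one_left (norm_nonneg _) (hG1 w)
  have h2 := ac_upper n hn (sq_nonneg ‖z‖) hz2
  calc _ ≤ (1 - ‖z‖^2)^n * (((n+1).factorial : ℝ) * ∑' k, ac n k * (‖z‖^2) ^ k) := by gcongr
    _ = ((n+1).factorial : ℝ) * ((1 - ‖z‖^2)^n * ∑' k, ac n k * (‖z‖^2) ^ k) := by ring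
    _ ≤ _ := by gcongr

lemma attain (n : ℕ) {z : ℂ} (hz : ‖z‖ < 1) : ∃ G : ℂ → ℂ, (Measurable G ∧ ∀ w, ‖G w‖ ≤ 1) ∧
    ‖iteratedDeriv n (bergP G) z‖ = ((n+1).factorial : ℝ) * ∑' k, ac n k * (‖z‖^2) ^ k := by
  let h : ℂ → ℂ := fun w => (starRingEnd ℂ) w ^ n / (1 - z * (starRingEnd ℂ) w) ^ (n+2)
  have hm : Measurable h := ker_meas n z
  let G : ℂ → ℂ := fun w => (starRingEnd ℂ) (h w) / (‖h w‖ : ℂ)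
  have hGm : Measurable G := (Complex.continuous_conj.measurable.comp hm).div
    (Complex.measurable_ofReal.comp hm.norm)
  have hG1 : ∀ w, ‖G w‖ ≤ 1 := by
    intro w
    simp only [G]
    rw [norm_div, RCLike.norm_conj, Complex.norm_real, norm_norm]
    exact div_self_le_one _
  refine ⟨G, ⟨hGm, hG1⟩, ?_⟩
  rw [iter_formula G hGm hG1 n z hz, norm_mul, Complex.norm_natCast, ← norm_ker_int n hz]
  congr 1
  have e : ∫ w, G w * ((starRingEnd ℂ) w ^ n / (1 - z * (starRingEnd ℂ) w) ^ (n+2)) ∂dm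
      = ((∫ w, ‖h w‖ ∂dm : ℝ) : ℂ) := by
    rw [← integral_complex_ofReal]
    congr 1
    ext w
    change (starRingEnd ℂ) (h w) / (‖h w‖ : ℂ) * h w = _
    rw [div_mul_eq_mul_div, mul_comm, Complex.mul_conj, Complex.normSq_eq_norm_sq]
    by_cases h0 : (‖h w‖ : ℂ) = 0
    · rw [h0]; simp
    · push_cast
      field_simp
  rw [e, Complex.norm_real, Real.norm_eq_abs, abs_of_nonneg (integral_nonneg fun w => norm_nonneg _)]

lemma const_eq (n : ℕ) (hn : 0 < n) : ((n+1).factorial : ℝ) * Lc n =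
    4 * (n + 1) * Real.Gamma n ^ 2 / (n * Real.Gamma ((n : ℝ) / 2) ^ 2) := by
  have hn' : (0:ℝ) < n := by exact_mod_cast hn
  have h1 : ((n+1).factorial : ℝ) = (n+1) * (n * Real.Gamma n) := by
    rw [Nat.factorial_succ, ← Real.Gamma_add_one hn'.ne', Real.Gamma_nat_eq_factorial]
    push_cast; rfl
  have h2 := Real.Gamma_pos_of_pos (s := (n:ℝ)/2) (by positivity)
  unfold Lc
  rw [h1, Real.Gamma_add_one (by positivity)]
  field_simp
  ring

/-- For the ordinary Bergman projection `P` on the unit disc and the Bloch seminorm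
`‖f‖_𝓑 = sup_{z∈U} (1-|z|²)^n |f^{(n)}(z)|`,
`‖P‖_{L^∞(U)→𝓑} = 4(n+1)Γ(n)²/(n Γ(n/2)²)`. -/
theorem bergman_projection_seminorm_disc_unweighted
    (n : ℕ) (hn : 0 < n) :
    (⨆ G : {G : ℂ → ℂ // Measurable G ∧ ∀ w, ‖G w‖ ≤ 1},
        ⨆ z : unitDisc, (1 - ‖(z : ℂ)‖ ^ 2) ^ n * ‖iteratedDeriv n (bergP G.1) (z : ℂ)‖) =
      4 * (n + 1) * Real.Gamma n ^ 2 / (n * Real.Gamma ((n : ℝ) / 2) ^ 2) := by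
  rw [← const_eq n hn]
  have hL := Lc_pos n hn
  have hf : (0:ℝ) < ((n+1).factorial : ℝ) := by positivity
  have hmem : ∀ z : unitDisc, ‖(z:ℂ)‖ < 1 := by
    rintro ⟨z, hz⟩
    simpa [unitDisc] using hz
  have hub : ∀ (G : {G : ℂ → ℂ // Measurable G ∧ ∀ w, ‖G w‖ ≤ 1}) (z : unitDisc),
      (1 - ‖(z : ℂ)‖ ^ 2) ^ n * ‖iteratedDeriv n (bergP G.1) (z : ℂ)‖ ≤
        ((n+1).factorial : ℝ) * Lc n :=
    fun G z => upper_bd n hn G.1 G.2.1 G.2.2 (hmem z)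
  have hub2 : ∀ (G : {G : ℂ → ℂ // Measurable G ∧ ∀ w, ‖G w‖ ≤ 1}),
      (⨆ z : unitDisc, (1 - ‖(z : ℂ)‖ ^ 2) ^ n * ‖iteratedDeriv n (bergP G.1) (z : ℂ)‖) ≤
        ((n+1).factorial : ℝ) * Lc n :=
    fun G => Real.iSup_le (hub G) (by positivity)
  apply le_antisymm
  · exact Real.iSup_le hub2 (by positivity)
  · apply le_of_forall_lt
    intro c hc
    have hc' : c / ((n+1).factorial : ℝ) < Lc n := by
      rw [div_lt_iff₀ hf]; linarith
    obtain ⟨x, h0, h1, hx⟩ := ac_lower n hn hc'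
    have hs0 := Real.sqrt_nonneg x
    have hnz : ‖((Real.sqrt x : ℝ) : ℂ)‖ = Real.sqrt x := by
      rw [Complex.norm_real, Real.norm_eq_abs, abs_of_nonneg hs0]
    have hz : ‖((Real.sqrt x : ℝ) : ℂ)‖ < 1 := by
      rw [hnz, Real.sqrt_lt' one_pos]; simpa using h1
    obtain ⟨G, hG, hGe⟩ := attain n hz
    have hzm : ((Real.sqrt x : ℝ) : ℂ) ∈ unitDisc := by
      rw [unitDisc, mem_ball_zero_iff]; exact hz
    have hb1 := le_ciSup (f := fun z : unitDisc =>
      (1 - ‖(z : ℂ)‖ ^ 2) ^ n * ‖iteratedDeriv n (bergP G) (z : ℂ)‖)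
      ⟨_, by rintro _ ⟨z, rfl⟩; exact hub ⟨G, hG⟩ z⟩ ⟨_, hzm⟩
    have hb2 := le_ciSup (f := fun G : {G : ℂ → ℂ // Measurable G ∧ ∀ w, ‖G w‖ ≤ 1} =>
      ⨆ z : unitDisc, (1 - ‖(z : ℂ)‖ ^ 2) ^ n * ‖iteratedDeriv n (bergP G.1) (z : ℂ)‖)
      ⟨_, by rintro _ ⟨G, rfl⟩; exact hub2 G⟩ ⟨G, hG⟩
    refine lt_of_lt_of_le ?_ (hb1.trans hb2)
    simp only
    rw [hGe, hnz, Real.sq_sqrt h0]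
    rw [div_lt_iff₀ hf] at hx
    linarith

end
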